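/- Let f : {0,1}^n → {0,1} be a monotone read-once DNF with m terms each containing exactly n/m variables (so every variable appears in exactly one term). Under unit costs and an arbitrary probability vector p ∈ (0,1)^n, there is a non-adaptive strategy S whose expected cost is at most min{n/m, m} · OPT_A(f, unit costs, p) ≤ √n · OPT_A(f, unit costs, p). -/

import Mathlib

open Finset

/-- The set of tested indices `T` determines `f` on input `x`:
every input agreeing with `x` on `T` gives the same function value. -/
def Determines (n : ℕ) (f : (Fin n → Bool) → Bool) (T : Finset (Fin n))
    (x : Fin n → Bool) : Prop :=
  ∀ x' : Fin n → Bool, (∀ i ∈ T, x' i = x i) → f x' = f x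

/-- The set of indices tested by the non-adaptive strategy `π` in its first `k` tests. -/
def prefixSet (n : ℕ) (π : Equiv.Perm (Fin n)) (k : ℕ) : Finset (Fin n) :=
  Finset.univ.filter (fun i => (π.symm i).val < k)

/-- The number of tests performed by the non-adaptive strategy `π` on input `x`:
the least `k` such that the first `k` tested indices determine `f` on `x`. -/
noncomputable def naSteps (n : ℕ) (f : (Fin n → Bool) → Bool)
    (π : Equiv.Perm (Fin n)) (x : Fin n → Bool) : ℕ :=
  sInf {k : ℕ | Determines n f (prefixSet n π k) x}

/-- The cost incurred by the non-adaptive strategy `π` on input `x`, with cost vector `c`. -/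
noncomputable def naCost (n : ℕ) (f : (Fin n → Bool) → Bool) (c : Fin n → ℝ)
    (π : Equiv.Perm (Fin n)) (x : Fin n → Bool) : ℝ :=
  ∑ i ∈ prefixSet n π (naSteps n f π x), c i

/-- Probability of the outcome `x` under the product distribution with parameters `p`. -/
def prodWeight (n : ℕ) (p : Fin n → ℝ) (x : Fin n → Bool) : ℝ :=
  ∏ i : Fin n, if x i then p i else 1 - p i

/-- Expected cost of the non-adaptive strategy `π`. -/
noncomputable def naExpCost (n : ℕ) (f : (Fin n → Bool) → Bool) (c : Fin n → ℝ)
    (p : Fin n → ℝ) (π : Equiv.Perm (Fin n)) : ℝ :=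
  ∑ x : Fin n → Bool, prodWeight n p x * naCost n f c π x

/-- Optimal expected cost among non-adaptive strategies. -/
noncomputable def OPTN (n : ℕ) (f : (Fin n → Bool) → Bool) (c : Fin n → ℝ)
    (p : Fin n → ℝ) : ℝ :=
  sInf { r : ℝ | ∃ π : Equiv.Perm (Fin n), r = naExpCost n f c p π }

/-- Binary decision trees over `n` variables (adaptive strategies). -/
inductive DecTree (n : ℕ) : Type
  | leaf : Bool → DecTree n
  | node : Fin n → DecTree n → DecTree n → DecTree n

/-- Evaluation of a decision tree on an input. -/
def DecTree.eval {n : ℕ} : DecTree n → (Fin n → Bool) → Bool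
  | .leaf b, _ => b
  | .node i t0 t1, x => if x i then DecTree.eval t1 x else DecTree.eval t0 x

/-- Cost of a decision tree on input `x`: the sum of the costs of the indices
labeling the internal nodes on the root-to-leaf path followed on `x`. -/
def DecTree.costOn {n : ℕ} (c : Fin n → ℝ) : DecTree n → (Fin n → Bool) → ℝ
  | .leaf _, _ => 0
  | .node i t0 t1, x =>
      c i + (if x i then DecTree.costOn c t1 x else DecTree.costOn c t0 x)

/-- The decision tree `t` computes the function `f`. -/
def DecTree.Computes {n : ℕ} (t : DecTree n) (f : (Fin n → Bool) → Bool) : Prop :=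
  ∀ x, t.eval x = f x

/-- Expected cost of an adaptive strategy (decision tree). -/
noncomputable def adExpCost (n : ℕ) (c : Fin n → ℝ) (p : Fin n → ℝ)
    (t : DecTree n) : ℝ :=
  ∑ x : Fin n → Bool, prodWeight n p x * DecTree.costOn c t x

/-- Optimal expected cost among adaptive strategies computing `f`. -/
noncomputable def OPTA (n : ℕ) (f : (Fin n → Bool) → Bool) (c : Fin n → ℝ)
    (p : Fin n → ℝ) : ℝ :=
  sInf { r : ℝ | ∃ t : DecTree n, DecTree.Computes t f ∧ r = adExpCost n c p t }

/-- `f` is the monotone read-once DNF whose terms are the (nonempty, pairwise disjoint)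
sets of variables `T 0, …, T (m-1)`. -/
def IsReadOnceDNF (n m : ℕ) (T : Fin m → Finset (Fin n))
    (f : (Fin n → Bool) → Bool) : Prop :=
  (∀ j, (T j).Nonempty) ∧
  (∀ j k, j ≠ k → Disjoint (T j) (T k)) ∧
  (∀ x, f x = true ↔ ∃ j, ∀ i ∈ T j, x i = true)


/-- Expectation under the product distribution. -/
noncomputable def Ex (n : ℕ) (p : Fin n → ℝ) (F : (Fin n → Bool) → ℝ) : ℝ :=
  ∑ x : Fin n → Bool, prodWeight n p x * F x

def Prob (n : ℕ) (p : Fin n → ℝ) : Prop := ∀ i, 0 ≤ p i ∧ p i ≤ 1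

def MultiAffine (n : ℕ) (G : (Fin n → ℝ) → ℝ) : Prop :=
  ∀ p i, G p = p i * G (Function.update p i 1) + (1 - p i) * G (Function.update p i 0)

lemma prodWeight_update (n : ℕ) (p : Fin n → ℝ) (i : Fin n) (v : ℝ) (x : Fin n → Bool) :
    prodWeight n (Function.update p i v) x =
      (if x i then v else 1 - v) * ∏ k ∈ univ.erase i, (if x k then p k else 1 - p k) := by
  unfold prodWeight
  rw [← Finset.mul_prod_erase univ _ (mem_univ i)]
  congr 1
  · simp
  · apply Finset.prod_congr rfl
    intro k hk
    rw [Function.update_of_ne (Finset.ne_of_mem_erase hk)]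

lemma prodWeight_split (n : ℕ) (p : Fin n → ℝ) (i : Fin n) (x : Fin n → Bool) :
    prodWeight n p x = p i * prodWeight n (Function.update p i 1) x +
      (1 - p i) * prodWeight n (Function.update p i 0) x := by
  rw [prodWeight_update, prodWeight_update]
  conv_lhs => rw [← Function.update_eq_self i p, prodWeight_update]
  cases x i <;> simp

lemma Ex_split (n : ℕ) (p : Fin n → ℝ) (i : Fin n) (F : (Fin n → Bool) → ℝ) :
    Ex n p F = p i * Ex n (Function.update p i 1) F +
      (1 - p i) * Ex n (Function.update p i 0) F := by
  unfold Ex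
  rw [Finset.mul_sum, Finset.mul_sum, ← Finset.sum_add_distrib]
  apply Finset.sum_congr rfl
  intro x _
  rw [prodWeight_split n p i x]
  ring

lemma Ex_one (n : ℕ) (p : Fin n → ℝ) (i : Fin n) (A B : (Fin n → Bool) → ℝ) :
    Ex n (Function.update p i 1) (fun x => if x i then A x else B x) =
      Ex n (Function.update p i 1) A := by
  unfold Ex
  apply Finset.sum_congr rfl
  intro x _
  rw [prodWeight_update]
  cases h : x i <;> simp [h]

lemma Ex_zero (n : ℕ) (p : Fin n → ℝ) (i : Fin n) (A B : (Fin n → Bool) → ℝ) :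
    Ex n (Function.update p i 0) (fun x => if x i then A x else B x) =
      Ex n (Function.update p i 0) B := by
  unfold Ex
  apply Finset.sum_congr rfl
  intro x _
  rw [prodWeight_update]
  cases h : x i <;> simp [h]

lemma Ex_ite (n : ℕ) (p : Fin n → ℝ) (i : Fin n) (A B : (Fin n → Bool) → ℝ) :
    Ex n p (fun x => if x i then A x else B x) =
      p i * Ex n (Function.update p i 1) A + (1 - p i) * Ex n (Function.update p i 0) B := by
  rw [Ex_split n p i, Ex_one, Ex_zero]

lemma prodWeight_nonneg (n : ℕ) (p : Fin n → ℝ) (hp : Prob n p) (x : Fin n → Bool) :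
    0 ≤ prodWeight n p x := by
  unfold prodWeight
  apply Finset.prod_nonneg
  intro i _
  have := hp i
  split_ifs <;> linarith

lemma Ex_mono (n : ℕ) (p : Fin n → ℝ) (hp : Prob n p) (F G : (Fin n → Bool) → ℝ)
    (h : ∀ x, F x ≤ G x) : Ex n p F ≤ Ex n p G := by
  unfold Ex
  apply Finset.sum_le_sum
  intro x _
  exact mul_le_mul_of_nonneg_left (h x) (prodWeight_nonneg n p hp x)

lemma Ex_add (n : ℕ) (p : Fin n → ℝ) (F G : (Fin n → Bool) → ℝ) :
    Ex n p (fun x => F x + G x) = Ex n p F + Ex n p G := by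
  unfold Ex
  rw [← Finset.sum_add_distrib]
  exact Finset.sum_congr rfl (fun x _ => by ring)

lemma Ex_smul (n : ℕ) (p : Fin n → ℝ) (c : ℝ) (F : (Fin n → Bool) → ℝ) :
    Ex n p (fun x => c * F x) = c * Ex n p F := by
  unfold Ex
  rw [Finset.mul_sum]
  exact Finset.sum_congr rfl (fun x _ => by ring)

lemma Ex_sum (n : ℕ) (p : Fin n → ℝ) (s : ℕ) (F : ℕ → (Fin n → Bool) → ℝ) :
    Ex n p (fun x => ∑ k ∈ range s, F k x) = ∑ k ∈ range s, Ex n p (F k) := by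
  unfold Ex
  rw [Finset.sum_comm]
  exact Finset.sum_congr rfl (fun x _ => by rw [Finset.mul_sum])

lemma Prob_update (n : ℕ) (p : Fin n → ℝ) (hp : Prob n p) (i : Fin n) (v : ℝ)
    (hv : 0 ≤ v ∧ v ≤ 1) : Prob n (Function.update p i v) := by
  intro k
  by_cases h : k = i
  · subst h; simpa using hv
  · rw [Function.update_of_ne h]; exact hp k

lemma Ex_eval (n : ℕ) (G : (Fin n → ℝ) → ℝ) (hG : MultiAffine n G) (p : Fin n → ℝ) :
    Ex n p (fun x => G (fun i => if x i then 1 else 0)) = G p := by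
  have key : ∀ s : Finset (Fin n), ∀ p : Fin n → ℝ, (∀ i, i ∉ s → p i = 0 ∨ p i = 1) →
      Ex n p (fun x => G (fun i => if x i then 1 else 0)) = G p := by
    intro s
    induction s using Finset.induction_on with
    | empty =>
      intro p h
      unfold Ex
      rw [Finset.sum_eq_single (fun i => decide (p i = 1))]
      · have e : (fun i => if (decide (p i = 1)) = true then (1:ℝ) else 0) = p := by
          funext i
          rcases h i (by simp) with h0 | h0 <;> simp [h0]
        simp only [e]
        have : prodWeight n p (fun i => decide (p i = 1)) = 1 := by
          unfold prodWeight
          apply Finset.prod_eq_one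
          intro i _
          rcases h i (by simp) with h0 | h0 <;> simp [h0]
        rw [this, one_mul]
      · intro x _ hx
        have : ∃ i, x i ≠ decide (p i = 1) := by
          by_contra hc
          push Not at hc
          exact hx (funext hc)
        obtain ⟨i, hi⟩ := this
        have : prodWeight n p x = 0 := by
          unfold prodWeight
          apply Finset.prod_eq_zero (mem_univ i)
          rcases h i (by simp) with h0 | h0 <;> simp [h0] at hi ⊢ <;> simp [hi]
        rw [this, zero_mul]
      · simp
    | insert a s ha ih =>
      intro p h
      rw [Ex_split n p a, hG p a, ih, ih]
      · intro i hi
        by_cases hia : i = a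
        · subst hia; simp
        · rw [Function.update_of_ne hia]; exact h i (by simp [hi, hia])
      · intro i hi
        by_cases hia : i = a
        · subst hia; simp
        · rw [Function.update_of_ne hia]; exact h i (by simp [hi, hia])
  exact key univ p (by simp)

lemma Ex_const (n : ℕ) (p : Fin n → ℝ) (c : ℝ) : Ex n p (fun _ => c) = c :=
  Ex_eval n (fun _ => c) (fun p i => by ring) p

def D {n m : ℕ} (A : Fin m → Finset (Fin n)) (S : Finset (Fin m)) (p : Fin n → ℝ) : ℝ :=
  ∏ j ∈ S, (1 - ∏ i ∈ A j, p i)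

lemma D_affine {n m : ℕ} (A : Fin m → Finset (Fin n))
    (hA : ∀ j k, j ≠ k → Disjoint (A j) (A k)) (S : Finset (Fin m)) :
    MultiAffine n (D A S) := by
  intro p i
  by_cases h : ∃ j ∈ S, i ∈ A j
  · obtain ⟨j, hj, hij⟩ := h
    have e : ∀ p : Fin n → ℝ, D A S p = (1 - ∏ i ∈ A j, p i) * D A (S.erase j) p := by
      intro p; unfold D; exact (Finset.mul_prod_erase S (fun j => 1 - ∏ i ∈ A j, p i) hj).symm
    have e2 : ∀ v, D A (S.erase j) (Function.update p i v) = D A (S.erase j) p := by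
      intro v
      unfold D
      apply Finset.prod_congr rfl
      intro k hk
      rw [Finset.prod_update_of_notMem]
      intro hik
      exact Finset.disjoint_left.mp (hA k j (Finset.ne_of_mem_erase hk)) hik hij
    rw [e, e, e, e2, e2, Finset.prod_update_of_mem hij, Finset.prod_update_of_mem hij]
    have : ∏ i ∈ A j, p i = p i * ∏ x ∈ A j \ {i}, p x := by
      rw [Finset.sdiff_singleton_eq_erase, Finset.mul_prod_erase _ _ hij]
    rw [this]; ring
  · push Not at h
    have e2 : ∀ v, D A S (Function.update p i v) = D A S p := by
      intro v
      unfold D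
      apply Finset.prod_congr rfl
      intro k hk
      rw [Finset.prod_update_of_notMem (h k hk)]
    rw [e2, e2]; ring

lemma prod01 {n : ℕ} (p : Fin n → ℝ) (hp : Prob n p) (A : Finset (Fin n)) :
    0 ≤ ∏ i ∈ A, p i ∧ ∏ i ∈ A, p i ≤ 1 :=
  ⟨Finset.prod_nonneg (fun i _ => (hp i).1),
    Finset.prod_le_one (fun i _ => (hp i).1) (fun i _ => (hp i).2)⟩

lemma D01 {n m : ℕ} (A : Fin m → Finset (Fin n)) (S : Finset (Fin m)) (p : Fin n → ℝ)
    (hp : Prob n p) : 0 ≤ D A S p ∧ D A S p ≤ 1 := by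
  unfold D
  constructor
  · exact Finset.prod_nonneg (fun j _ => by linarith [(prod01 p hp (A j)).2])
  · exact Finset.prod_le_one (fun j _ => by linarith [(prod01 p hp (A j)).2])
      (fun j _ => by linarith [(prod01 p hp (A j)).1])

/-! Non-adaptive strategies from keys -/

lemma exists_perm_key (n : ℕ) (r : Fin n → ℕ) : ∃ π : Equiv.Perm (Fin n),
    ∀ k, prefixSet n π (#{i | r i < k}) = ({i | r i < k} : Finset (Fin n)) := by
  refine ⟨Tuple.sort r, fun k => ?_⟩
  set π := Tuple.sort r
  have mono : Monotone (r ∘ π) := Tuple.monotone_sort r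
  symm
  apply Finset.eq_of_subset_of_card_le
  · intro i hi
    simp only [prefixSet, mem_filter, mem_univ, true_and] at hi ⊢
    have : #(Finset.Iic (π.symm i)) ≤ #{i | r i < k} := by
      apply Finset.card_le_card_of_injOn π
      · intro a ha
        simp only [coe_Iic, Set.mem_Iic] at ha
        have := mono ha
        simp only [Function.comp, Equiv.apply_symm_apply] at this
        simp; omega
      · exact π.injective.injOn
    rw [Fin.card_Iic] at this
    omega
  · have : #(prefixSet n π (#{i | r i < k})) ≤ #(Finset.range (#{i | r i < k})) := by
      apply Finset.card_le_card_of_injOn (fun i => (π.symm i).val)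
      · intro a ha
        simpa [prefixSet] using ha
      · intro a _ b _ hab
        exact π.symm.injective (Fin.ext hab)
    simpa using this

lemma naCost_le (n : ℕ) (f : (Fin n → Bool) → Bool) (π : Equiv.Perm (Fin n))
    (x : Fin n → Bool) (k : ℕ) (h : Determines n f (prefixSet n π k) x) :
    naCost n f (fun _ => 1) π x ≤ k := by
  unfold naCost
  have h1 : naSteps n f π x ≤ k := Nat.sInf_le h
  have h2 : #(prefixSet n π (naSteps n f π x)) ≤ #(Finset.range (naSteps n f π x)) := by
    apply Finset.card_le_card_of_injOn (fun i => (π.symm i).val)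
    · intro a ha
      simpa [prefixSet] using ha
    · intro a _ b _ hab
      exact π.symm.injective (Fin.ext hab)
  rw [Finset.card_range] at h2
  simp only [sum_const, nsmul_eq_mul, mul_one]
  exact_mod_cast h2.trans h1

/-! Trees -/

def DecTree.steps {n : ℕ} : DecTree n → (Fin n → Bool) → ℕ
  | .leaf _, _ => 0
  | .node i t0 t1, x => 1 + (if x i then t1.steps x else t0.steps x)

lemma costOn_eq {n : ℕ} (t : DecTree n) (x : Fin n → Bool) :
    t.costOn (fun _ => 1) x = t.steps x := by
  induction t with
  | leaf b => simp [DecTree.costOn, DecTree.steps]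
  | node i t0 t1 h0 h1 =>
    simp only [DecTree.costOn, DecTree.steps, h0, h1]
    split_ifs <;> push_cast <;> rfl

def Supp {n : ℕ} (p : Fin n → ℝ) (x : Fin n → Bool) : Prop :=
  ∀ i, (p i = 0 → x i = false) ∧ (p i = 1 → x i = true)

def CompOn {n : ℕ} (t : DecTree n) (f : (Fin n → Bool) → Bool) (p : Fin n → ℝ) : Prop :=
  ∀ x, Supp p x → t.eval x = f x

lemma CompOn_one {n : ℕ} (i : Fin n) (t0 t1 : DecTree n) (f : (Fin n → Bool) → Bool)
    (p : Fin n → ℝ) (h : CompOn (.node i t0 t1) f p) (hi : p i ≠ 0) :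
    CompOn t1 f (Function.update p i 1) := by
  intro x hx
  have hxi : x i = true := (hx i).2 (by simp)
  rw [← h x]
  · simp [DecTree.eval, hxi]
  · intro k
    by_cases hk : k = i
    · subst hk; simp [hi, hxi]
    · have := hx k
      rwa [Function.update_of_ne hk] at this

lemma CompOn_zero {n : ℕ} (i : Fin n) (t0 t1 : DecTree n) (f : (Fin n → Bool) → Bool)
    (p : Fin n → ℝ) (h : CompOn (.node i t0 t1) f p) (hi : p i ≠ 1) :
    CompOn t0 f (Function.update p i 0) := by
  intro x hx
  have hxi : x i = false := (hx i).1 (by simp)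
  rw [← h x]
  · simp [DecTree.eval, hxi]
  · intro k
    by_cases hk : k = i
    · subst hk; simp [hi, hxi]
    · have := hx k
      rwa [Function.update_of_ne hk] at this

lemma leaf_false {n m : ℕ} (T : Fin m → Finset (Fin n)) (f : (Fin n → Bool) → Bool)
    (hf : IsReadOnceDNF n m T f) (p : Fin n → ℝ) (h : CompOn (.leaf false) f p) (j : Fin m) :
    ∃ i ∈ T j, p i = 0 := by
  have h1 := h (fun i => decide (p i ≠ 0)) (by
    intro i; constructor
    · intro h; simp [h]
    · intro h; simp [h])
  simp only [DecTree.eval] at h1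
  by_contra hc
  push Not at hc
  have := (hf.2.2 (fun i => decide (p i ≠ 0))).2 ⟨j, fun i hi => by simp [hc i hi]⟩
  rw [← h1] at this
  simp at this

lemma leaf_true {n m : ℕ} (T : Fin m → Finset (Fin n)) (f : (Fin n → Bool) → Bool)
    (hf : IsReadOnceDNF n m T f) (p : Fin n → ℝ) (h : CompOn (.leaf true) f p) :
    ∃ j, ∀ i ∈ T j, p i = 1 := by
  have h1 := h (fun i => decide (p i = 1)) (by
    intro i; constructor
    · intro h; simp [h]
    · intro h; simp [h])
  simp only [DecTree.eval] at h1
  obtain ⟨j, hj⟩ := (hf.2.2 _).1 h1.symm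
  exact ⟨j, fun i hi => by simpa using hj i hi⟩

lemma exists_tree {n : ℕ} (l : List (Fin n)) : ∀ (f : (Fin n → Bool) → Bool),
    (∀ x y, (∀ i ∈ l, x i = y i) → f x = f y) → ∃ t : DecTree n, t.Computes f := by
  induction l with
  | nil =>
    intro f h
    exact ⟨.leaf (f (fun _ => false)), fun x => h _ _ (by simp)⟩
  | cons i l ih =>
    intro f h
    have aux : ∀ b, ∃ t : DecTree n, t.Computes (fun x => f (Function.update x i b)) := by
      intro b
      apply ih
      intro x y hxy
      apply h
      intro k hk
      by_cases hki : k = i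
      · subst hki; simp
      · rw [Function.update_of_ne hki, Function.update_of_ne hki]
        exact hxy k (by simpa [hki] using hk)
    obtain ⟨t0, h0⟩ := aux false
    obtain ⟨t1, h1⟩ := aux true
    refine ⟨.node i t0 t1, fun x => ?_⟩
    simp only [DecTree.eval]
    split_ifs with hx
    · rw [h1 x, ← hx]
      simp only [Function.update_eq_self]
    · rw [h0 x]
      simp only [Bool.not_eq_true] at hx
      rw [← hx]
      simp only [Function.update_eq_self]

/-! Case A -/

lemma treeA {n m : ℕ} (T : Fin m → Finset (Fin n)) (f : (Fin n → Bool) → Bool)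
    (hcover : ∀ i : Fin n, ∃ j, i ∈ T j)
    (hf : IsReadOnceDNF n m T f) (p₀ : Fin n → ℝ) (hp₀ : ∀ i, 0 < p₀ i ∧ p₀ i < 1)
    (V : Finset (Fin m) → ℝ) (hV0 : V ∅ = 0)
    (hV : ∀ U, ∀ j ∈ U, V U ≤ 1 + (1 - ∏ i ∈ T j, p₀ i) * V (U.erase j))
    (t : DecTree n) : ∀ (p : Fin n → ℝ) (U : Finset (Fin m)), Prob n p → CompOn t f p →
      (∀ j ∈ U, ∀ i ∈ T j, p i = p₀ i) →
      D T Uᶜ p * V U ≤ Ex n p (fun x => (t.steps x : ℝ)) := by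
  induction t with
  | leaf b =>
    intro p U hp hc hU
    have : Ex n p (fun x => ((DecTree.leaf b).steps x : ℝ)) = 0 := by
      simp [DecTree.steps, Ex_const]
    rw [this]
    apply le_of_eq
    cases b with
    | false =>
      have : U = ∅ := by
        rw [Finset.eq_empty_iff_forall_notMem]
        intro j hj
        obtain ⟨i, hi, h0⟩ := leaf_false T f hf p hc j
        have := hU j hj i hi
        linarith [(hp₀ i).1]
      rw [this, hV0, mul_zero]
    | true =>
      obtain ⟨j, hj⟩ := leaf_true T f hf p hc
      have hjU : j ∉ U := by
        intro h
        obtain ⟨i, hi⟩ := hf.1 j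
        have h1 := hU j h i hi
        have h2 := hj i hi
        linarith [(hp₀ i).2]
      have : D T Uᶜ p = 0 := by
        unfold D
        apply Finset.prod_eq_zero (i := j) (by simpa using hjU)
        rw [Finset.prod_eq_one hj, sub_self]
      rw [this, zero_mul]
  | node i t0 t1 ih0 ih1 =>
    intro p U hp hc hU
    have hE : Ex n p (fun x => ((DecTree.node i t0 t1).steps x : ℝ)) =
        1 + (p i * Ex n (Function.update p i 1) (fun x => (t1.steps x : ℝ)) +
          (1 - p i) * Ex n (Function.update p i 0) (fun x => (t0.steps x : ℝ))) := by
      rw [← Ex_ite, ← Ex_const n p 1, ← Ex_add]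
      congr 1
      funext x
      simp only [DecTree.steps]
      push_cast
      rfl
    rw [hE]
    obtain ⟨j, hj⟩ := hcover i
    -- common bound with `U.erase j`
    have hstep : D T (U.erase j)ᶜ p * V (U.erase j) ≤
        p i * Ex n (Function.update p i 1) (fun x => (t1.steps x : ℝ)) +
          (1 - p i) * Ex n (Function.update p i 0) (fun x => (t0.steps x : ℝ)) := by
      have hU' : ∀ v, ∀ j' ∈ U.erase j, ∀ k ∈ T j', Function.update p i v k = p₀ k := by
        intro v j' hj' k hk
        have hne := Finset.ne_of_mem_erase hj'
        have hki : k ≠ i := by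
          intro hki
          rw [hki] at hk
          exact Finset.disjoint_left.mp (hf.2.1 j' j hne) hk hj
        rw [Function.update_of_ne hki]
        exact hU j' (Finset.mem_of_mem_erase hj') k hk
      rw [D_affine T hf.2.1 _ p i, add_mul, mul_assoc, mul_assoc]
      apply add_le_add
      · by_cases h : p i = 0
        · simp [h]
        · exact mul_le_mul_of_nonneg_left (ih1 _ _ (Prob_update n p hp i 1 (by norm_num))
            (CompOn_one i t0 t1 f p hc h) (hU' 1)) (hp i).1
      · by_cases h : p i = 1
        · simp [h]
        · exact mul_le_mul_of_nonneg_left (ih0 _ _ (Prob_update n p hp i 0 (by norm_num))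
            (CompOn_zero i t0 t1 f p hc h) (hU' 0)) (by linarith [(hp i).2])
    by_cases hjU : j ∈ U
    · have e1 : (U.erase j)ᶜ = insert j Uᶜ := by
        ext k; simp [or_iff_not_imp_left]
      have e2 : D T (U.erase j)ᶜ p = (1 - ∏ i ∈ T j, p₀ i) * D T Uᶜ p := by
        rw [e1]
        unfold D
        rw [Finset.prod_insert (by simpa using hjU)]
        congr 2
        exact Finset.prod_congr rfl (hU j hjU)
      have hD := D01 T Uᶜ p hp
      have := mul_le_mul_of_nonneg_left (hV U j hjU) hD.1
      rw [e2] at hstep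
      nlinarith
    · rw [Finset.erase_eq_of_notMem hjU] at hstep
      linarith

def Cl {m : ℕ} (q : Fin m → ℝ) : List (Fin m) → ℝ
  | [] => 0
  | j :: l => 1 + (1 - q j) * Cl q l

lemma Cl_congr {m : ℕ} (q q' : Fin m → ℝ) (l : List (Fin m)) (h : ∀ j ∈ l, q j = q' j) :
    Cl q l = Cl q' l := by
  induction l with
  | nil => rfl
  | cons j l ih =>
    simp only [Cl]
    rw [h j (by simp), ih (fun k hk => h k (by simp [hk]))]

lemma Cl_affine {n m : ℕ} (T : Fin m → Finset (Fin n))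
    (hT : ∀ j k, j ≠ k → Disjoint (T j) (T k)) (l : List (Fin m)) (hl : l.Nodup) :
    MultiAffine n (fun p => Cl (fun j => ∏ i ∈ T j, p i) l) := by
  induction l with
  | nil => intro p i; simp [Cl]
  | cons j l ih =>
    intro p i
    rw [List.nodup_cons] at hl
    simp only [Cl]
    by_cases hij : i ∈ T j
    · have e : ∀ v, Cl (fun j => ∏ k ∈ T j, Function.update p i v k) l =
          Cl (fun j => ∏ k ∈ T j, p k) l := by
        intro v
        apply Cl_congr
        intro k hk
        rw [Finset.prod_update_of_notMem]
        intro hik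
        have hkj : k ≠ j := by rintro rfl; exact hl.1 hk
        exact Finset.disjoint_left.mp (hT k j hkj) hik hij
      rw [e, e, Finset.prod_update_of_mem hij, Finset.prod_update_of_mem hij]
      have : ∏ i ∈ T j, p i = p i * ∏ x ∈ T j \ {i}, p x := by
        rw [Finset.sdiff_singleton_eq_erase, Finset.mul_prod_erase _ _ hij]
      rw [this]; ring
    · have := ih hl.2 p i
      simp only at this
      rw [this, Finset.prod_update_of_notMem hij, Finset.prod_update_of_notMem hij]
      ring

lemma exists_opt {m : ℕ} (q : Fin m → ℝ) : ∃ L : Finset (Fin m) → List (Fin m),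
    (∀ U, (L U).Nodup ∧ (L U).toFinset = U) ∧
    ∀ U l, l.Nodup → l.toFinset = U → Cl q (L U) ≤ Cl q l := by
  have : ∀ U : Finset (Fin m), ∃ l : List (Fin m), (l.Nodup ∧ l.toFinset = U) ∧
      ∀ l', l'.Nodup → l'.toFinset = U → Cl q l ≤ Cl q l' := by
    intro U
    have hfin : {l : List (Fin m) | l.Nodup ∧ l.toFinset = U}.Finite := by
      apply Set.Finite.subset (List.finite_length_le (Fin m) (Fintype.card (Fin m)))
      intro l hl
      exact hl.1.length_le_card
    obtain ⟨l, hl, h⟩ := Set.exists_min_image _ (Cl q) hfin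
      ⟨U.toList, U.nodup_toList, by simp⟩
    exact ⟨l, hl, fun l' h1 h2 => h l' ⟨h1, h2⟩⟩
  choose L h1 h2 using this
  exact ⟨L, h1, h2⟩

lemma Cl_count {m : ℕ} (b : Fin m → Prop) [DecidablePred b] (q : Fin m → ℝ)
    (hq : ∀ j, q j = if b j then 1 else 0) (l : List (Fin m)) :
    ∃ k : ℕ, Cl q l = k ∧ (k = l.length ∨ ∃ j ∈ l, l.idxOf j < k ∧ b j) := by
  induction l with
  | nil => exact ⟨0, by simp [Cl]⟩
  | cons j l ih =>
    by_cases hb : b j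
    · exact ⟨1, by simp [Cl, hq, hb], Or.inr ⟨j, by simp, by simp, hb⟩⟩
    · obtain ⟨k, hk, h⟩ := ih
      refine ⟨k + 1, by simp [Cl, hq j, hb, hk]; ring, ?_⟩
      rcases h with h | ⟨j', h1, h2, h3⟩
      · left; simp [h]
      · right
        refine ⟨j', by simp [h1], ?_, h3⟩
        have : j ≠ j' := by rintro rfl; exact hb h3
        rw [List.idxOf_cons_ne _ this]
        omega

lemma determines_univ {n : ℕ} (f : (Fin n → Bool) → Bool) (S : Finset (Fin n))
    (hS : ∀ i, i ∈ S) (x : Fin n → Bool) : Determines n f S x := by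
  intro x' h
  congr 1
  funext i
  exact h i (hS i)

lemma caseA {n m s : ℕ} (T : Fin m → Finset (Fin n)) (f : (Fin n → Bool) → Bool)
    (hcard : ∀ j, (T j).card = s)
    (hcover : ∀ i : Fin n, ∃ j, i ∈ T j)
    (hf : IsReadOnceDNF n m T f) (p : Fin n → ℝ) (hp : ∀ i, 0 < p i ∧ p i < 1) :
    ∃ π : Equiv.Perm (Fin n), ∀ t : DecTree n, t.Computes f →
      naExpCost n f (fun _ => 1) p π ≤ s * adExpCost n (fun _ => 1) p t := by
  have hP : Prob n p := fun i => ⟨(hp i).1.le, (hp i).2.le⟩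
  obtain ⟨L, hL, hopt⟩ := exists_opt (fun j => ∏ i ∈ T j, p i)
  set l := L univ with hl
  have hmem : ∀ j, j ∈ l := by
    intro j
    rw [← List.mem_toFinset, (hL univ).2]; simp
  choose tm htm using hcover
  have htm' : ∀ i j, i ∈ T j → tm i = j := by
    intro i j hij
    by_contra hne
    exact Finset.disjoint_left.mp (hf.2.1 _ _ hne) (htm i) hij
  obtain ⟨π, hπ⟩ := exists_perm_key n (fun i => l.idxOf (tm i))
  refine ⟨π, fun t ht => ?_⟩
  have hA : Cl (fun j => ∏ i ∈ T j, p i) l ≤ adExpCost n (fun _ => 1) p t := by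
    have h := treeA T f (fun i => ⟨tm i, htm i⟩) hf p hp
      (fun U => Cl (fun j => ∏ i ∈ T j, p i) (L U))
      (by
        have : L ∅ = [] := by simpa using (hL ∅).2
        simp [this, Cl])
      (by
        intro U j hj
        have h1 := hL (U.erase j)
        have hnj : j ∉ L (U.erase j) := by
          rw [← List.mem_toFinset, h1.2]; simp
        exact hopt U (j :: L (U.erase j)) (List.nodup_cons.2 ⟨hnj, h1.1⟩)
          (by rw [List.toFinset_cons, h1.2, Finset.insert_erase hj]))
      t p univ hP (fun x _ => ht x) (fun _ _ _ _ => rfl)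
    simp only [compl_univ, D, prod_empty, one_mul] at h
    refine h.trans (le_of_eq ?_)
    unfold Ex adExpCost
    simp only [costOn_eq]
  have hN : naExpCost n f (fun _ => 1) p π ≤ s * Cl (fun j => ∏ i ∈ T j, p i) l := by
    have e := Ex_eval n _ (Cl_affine T hf.2.1 l (hL univ).1) p
    simp only at e
    rw [← e, ← Ex_smul]
    change Ex n p _ ≤ _
    apply Ex_mono n p hP
    intro x
    obtain ⟨k, hk, hk2⟩ := Cl_count (fun j => ∀ i ∈ T j, x i = true)
      (fun j => ∏ i ∈ T j, if x i = true then (1:ℝ) else 0) (by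
        intro j
        split_ifs with h
        · exact Finset.prod_eq_one (fun i hi => by simp [h i hi])
        · push Not at h
          obtain ⟨i, hi, hxi⟩ := h
          exact Finset.prod_eq_zero hi (by simp [hxi])) l
    rw [hk]
    have hdet : Determines n f ({i | l.idxOf (tm i) < k} : Finset (Fin n)) x := by
      rcases hk2 with h | ⟨j, _, h2, h3⟩
      · apply determines_univ
        intro i
        simp only [mem_filter, mem_univ, true_and, h]
        exact List.idxOf_lt_length_iff.2 (hmem _)
      · intro x' hx'
        rw [(hf.2.2 x).2 ⟨j, h3⟩, (hf.2.2 x').2 ⟨j, fun i hi => ?_⟩]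
        rw [hx' i, h3 i hi]
        simp only [mem_filter, mem_univ, true_and]
        rw [htm' i j hi]; exact h2
    rw [← hπ k] at hdet
    refine (naCost_le n f π x _ hdet).trans ?_
    have hc : #{i | l.idxOf (tm i) < k} ≤ s * #(Finset.range k) := by
      apply Finset.card_le_mul_card_image_of_maps_to (f := fun i => l.idxOf (tm i))
      · intro i hi; simpa using hi
      · intro b hb
        by_cases hne : ∃ i₀, l.idxOf (tm i₀) = b
        · obtain ⟨i₀, h0⟩ := hne
          rw [← hcard (tm i₀)]
          apply Finset.card_le_card
          intro i hi
          simp only [mem_filter] at hi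
          have := (List.idxOf_inj (hmem (tm i))).1 (hi.2.trans h0.symm)
          rw [← this]; exact htm i
        · push Not at hne
          rw [Finset.filter_false_of_mem (fun i _ => hne i)]
          simp
    rw [Finset.card_range] at hc
    exact_mod_cast hc
  exact hN.trans (mul_le_mul_of_nonneg_left hA (by positivity))

/-! Case B -/

lemma exists_rank {n : ℕ} (p : Fin n → ℝ) (T : Finset (Fin n)) : ∃ r : Fin n → ℕ,
    (∀ a ∈ T, ∀ b ∈ T, r a = r b → a = b) ∧ (∀ a ∈ T, r a < #T) ∧
    ∀ a ∈ T, ∀ b ∈ T, r a < r b → p a ≤ p b := by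
  induction T using Finset.induction_on_max_value p with
  | empty => exact ⟨fun _ => 0, by simp, by simp, by simp⟩
  | insert a s ha hmax ih =>
    obtain ⟨r, h1, h2, h3⟩ := ih
    have hr : ∀ b ∈ s, Function.update r a #s b = r b := by
      intro b hb
      rw [Function.update_of_ne]
      rintro rfl; exact ha hb
    have hra : Function.update r a #s a = #s := by simp
    refine ⟨Function.update r a #s, ?_, ?_, ?_⟩
    · intro b hb c hc hbc
      rw [Finset.mem_insert] at hb hc
      rcases hb with rfl | hb <;> rcases hc with rfl | hc
      · rfl
      · rw [hra, hr c hc] at hbc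
        have := h2 c hc; omega
      · rw [hra, hr b hb] at hbc
        have := h2 b hb; omega
      · rw [hr b hb, hr c hc] at hbc
        exact h1 b hb c hc hbc
    · intro b hb
      rw [Finset.card_insert_of_notMem ha]
      rw [Finset.mem_insert] at hb
      rcases hb with rfl | hb
      · rw [hra]; omega
      · rw [hr b hb]; have := h2 b hb; omega
    · intro b hb c hc hbc
      rw [Finset.mem_insert] at hb hc
      rcases hb with rfl | hb <;> rcases hc with rfl | hc
      · exact le_rfl
      · rw [hra, hr c hc] at hbc
        have := h2 c hc; omega
      · exact hmax b hb
      · rw [hr b hb, hr c hc] at hbc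
        exact h3 b hb c hc hbc

lemma rank_card {n : ℕ} (T : Finset (Fin n)) (r : Fin n → ℕ)
    (h1 : ∀ a ∈ T, ∀ b ∈ T, r a = r b → a = b) (h2 : ∀ a ∈ T, r a < #T) (k : ℕ)
    (hk : k ≤ #T) : #{i ∈ T | r i < k} = k := by
  have himg : T.image r = range #T := by
    apply Finset.eq_of_subset_of_card_le
    · intro b hb
      obtain ⟨a, ha, rfl⟩ := Finset.mem_image.1 hb
      exact Finset.mem_range.2 (h2 a ha)
    · rw [Finset.card_image_of_injOn (fun a ha b hb h => h1 a ha b hb h), Finset.card_range]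
  have : ({i ∈ T | r i < k}).image r = range k := by
    ext b
    simp only [mem_image, mem_filter, mem_range]
    constructor
    · rintro ⟨a, ⟨_, h⟩, rfl⟩; exact h
    · intro hb
      have : b ∈ T.image r := by rw [himg, mem_range]; omega
      obtain ⟨a, ha, rfl⟩ := Finset.mem_image.1 this
      exact ⟨a, ⟨ha, hb⟩, rfl⟩
  have h4 : #(({i ∈ T | r i < k}).image r) = #{i ∈ T | r i < k} := by
    apply Finset.card_image_of_injOn
    intro a ha b hb h
    exact h1 a (Finset.mem_filter.1 ha).1 b (Finset.mem_filter.1 hb).1 h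
  rw [← h4, this, Finset.card_range]

lemma exch {n : ℕ} (p : Fin n → ℝ) (hp : Prob n p) (T : Finset (Fin n)) (r : Fin n → ℕ)
    (h1 : ∀ a ∈ T, ∀ b ∈ T, r a = r b → a = b) (h2 : ∀ a ∈ T, r a < #T)
    (h3 : ∀ a ∈ T, ∀ b ∈ T, r a < r b → p a ≤ p b) (k : ℕ) (hk : k ≤ #T)
    (S : Finset (Fin n)) (hS : S ⊆ T) (hSk : #S ≤ k) :
    ∏ i ∈ T with r i < k, p i ≤ ∏ i ∈ S, p i := by
  set A := ({i ∈ T | r i < k} : Finset (Fin n)) with hA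
  have hAc : #A = k := rank_card T r h1 h2 k hk
  have eA : ∏ i ∈ A, p i = (∏ i ∈ A ∩ S, p i) * ∏ i ∈ A \ S, p i := by
    rw [Finset.prod_inter_mul_prod_sdiff]
  have eS : ∏ i ∈ S, p i = (∏ i ∈ A ∩ S, p i) * ∏ i ∈ S \ A, p i := by
    rw [Finset.inter_comm, Finset.prod_inter_mul_prod_sdiff]
  rw [eA, eS]
  apply mul_le_mul_of_nonneg_left _ (prod01 p hp _).1
  rcases (S \ A).eq_empty_or_nonempty with he | hne
  · rw [he, Finset.prod_empty]; exact (prod01 p hp _).2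
  · obtain ⟨b, hb, hbmin⟩ := Finset.exists_min_image (S \ A) p hne
    have hc : #(S \ A) ≤ #(A \ S) := by
      have e1 := Finset.card_sdiff_add_card_inter S A
      have e2 := Finset.card_sdiff_add_card_inter A S
      rw [Finset.inter_comm] at e2
      omega
    have hbT : b ∈ T := hS (Finset.mem_sdiff.1 hb).1
    have hbk : k ≤ r b := by
      by_contra hlt
      exact (Finset.mem_sdiff.1 hb).2 (by simp [hA, hbT]; omega)
    calc ∏ i ∈ A \ S, p i ≤ ∏ _i ∈ A \ S, p b := by
          apply Finset.prod_le_prod (fun i _ => (hp i).1)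
          intro i hi
          have hiA := (Finset.mem_sdiff.1 hi).1
          simp only [hA, mem_filter] at hiA
          exact h3 i hiA.1 b hbT (by omega)
      _ = p b ^ #(A \ S) := by rw [Finset.prod_const]
      _ ≤ p b ^ #(S \ A) := pow_le_pow_of_le_one (hp b).1 (hp b).2 hc
      _ = ∏ _i ∈ S \ A, p b := by rw [Finset.prod_const]
      _ ≤ ∏ i ∈ S \ A, p i := Finset.prod_le_prod (fun i _ => (hp b).1) hbmin

lemma treeB {n m : ℕ} (T : Fin m → Finset (Fin n)) (f : (Fin n → Bool) → Bool)
    (hcover : ∀ i : Fin n, ∃ j, i ∈ T j)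
    (hf : IsReadOnceDNF n m T f)
    (t : DecTree n) : ∀ (p : Fin n → ℝ) (k : ℕ) (α : Fin m → ℝ), Prob n p → CompOn t f p →
      (∀ j, 0 ≤ α j) →
      (∀ j, ∀ S ⊆ T j, #{i ∈ S | p i ≠ 0} ≤ k → α j ≤ ∏ i ∈ S, p i) →
      (∀ j, k < #{i ∈ T j | p i ≠ 1}) →
      Ex n p (fun x => if t.steps x ≤ k then (1:ℝ) else 0) ≤ ∏ j, (1 - α j) := by
  induction t with
  | leaf b =>
    intro p k α hp hc hα hS hk
    simp only [DecTree.steps, Nat.zero_le, if_true, Ex_const]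
    cases b with
    | false =>
      apply le_of_eq
      symm
      apply Finset.prod_eq_one
      intro j _
      obtain ⟨i, hi, h0⟩ := leaf_false T f hf p hc j
      have := hS j {i} (by simpa using hi) (by simp [Finset.filter_singleton, h0])
      simp only [prod_singleton, h0] at this
      linarith [hα j]
    | true =>
      obtain ⟨j, hj⟩ := leaf_true T f hf p hc
      have := hk j
      rw [Finset.filter_false_of_mem (by simpa using hj)] at this
      simp at this
  | node i t0 t1 ih0 ih1 =>
    intro p k α hp hc hα hS hk
    have hα1 : ∀ j, α j ≤ 1 := by
      intro j
      simpa using hS j ∅ (by simp) (by simp)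
    cases k with
    | zero =>
      simp only [DecTree.steps]
      have : ∀ x : Fin n → Bool, ¬ (1 + (if x i = true then t1.steps x else t0.steps x) ≤ 0) := by
        intro x; omega
      simp only [this, if_false, Ex_const]
      exact Finset.prod_nonneg (fun j _ => by linarith [hα1 j])
    | succ k =>
      have hE : Ex n p (fun x => if (DecTree.node i t0 t1).steps x ≤ k + 1 then (1:ℝ) else 0) =
          p i * Ex n (Function.update p i 1) (fun x => if t1.steps x ≤ k then (1:ℝ) else 0) +
          (1 - p i) * Ex n (Function.update p i 0)
            (fun x => if t0.steps x ≤ k then (1:ℝ) else 0) := by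
        rw [← Ex_ite]
        congr 1
        funext x
        simp only [DecTree.steps]
        by_cases hx : x i = true <;> simp only [hx, if_true, if_false, Nat.add_comm 1, Nat.add_le_add_iff_right] <;> simp
      rw [hE]
      obtain ⟨j, hj⟩ := hcover i
      have hnot : ∀ j', j' ≠ j → i ∉ T j' := by
        intro j' hne hi
        exact Finset.disjoint_left.mp (hf.2.1 j' j hne) hi hj
      have hcnt : ∀ v j', k < #{l ∈ T j' | Function.update p i v l ≠ 1} := by
        intro v j'
        have h1 : ({l ∈ T j' | p l ≠ 1} : Finset (Fin n)) ⊆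
            insert i {l ∈ T j' | Function.update p i v l ≠ 1} := by
          intro l hl
          simp only [mem_filter, mem_insert] at hl ⊢
          by_cases hli : l = i
          · exact Or.inl hli
          · right; rwa [Function.update_of_ne hli]
        have h2 := (Finset.card_le_card h1).trans (Finset.card_insert_le _ _)
        have h3 := hk j'
        omega
      have hother : ∀ v j', j' ≠ j → ∀ S ⊆ T j', #{l ∈ S | Function.update p i v l ≠ 0} ≤ k →
          α j' ≤ ∏ l ∈ S, Function.update p i v l := by
        intro v j' hne S hST hcard
        have hiS : i ∉ S := fun h => hnot j' hne (hST h)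
        rw [Finset.prod_update_of_notMem hiS]
        apply hS j' S hST
        rw [Finset.filter_congr (q := fun l => p l ≠ 0)] at hcard
        · omega
        · intro l hl
          rw [Function.update_of_ne]
          rintro rfl; exact hiS hl
      have hsplit : ∀ v, ∏ j', (1 - Function.update α j v j') =
          (1 - v) * ∏ j' ∈ univ.erase j, (1 - α j') := by
        intro v
        rw [← Finset.mul_prod_erase univ _ (mem_univ j)]
        congr 1
        · simp
        · exact Finset.prod_congr rfl (fun l hl => by
            rw [Function.update_of_ne (Finset.ne_of_mem_erase hl)])
      have hb1 : p i * Ex n (Function.update p i 1)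
          (fun x => if t1.steps x ≤ k then (1:ℝ) else 0) ≤
          p i * ((1 - α j / p i) * ∏ j' ∈ univ.erase j, (1 - α j')) := by
        by_cases h : p i = 0
        · simp [h]
        · apply mul_le_mul_of_nonneg_left _ (hp i).1
          rw [← hsplit]
          have hpos : 0 < p i := lt_of_le_of_ne (hp i).1 (Ne.symm h)
          apply ih1 _ _ _ (Prob_update n p hp i 1 (by norm_num)) (CompOn_one i t0 t1 f p hc h)
            _ _ (hcnt 1)
          · intro j'
            by_cases hjj : j' = j
            · subst hjj; simp only [Function.update_self]; exact div_nonneg (hα _) (hp i).1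
            · rw [Function.update_of_ne hjj]; exact hα j'
          · intro j' S hST hcard
            by_cases hjj : j' = j
            · subst hjj
              simp only [Function.update_self]
              rw [div_le_iff₀ hpos]
              have h1 := hS j' (insert i S) (Finset.insert_subset hj hST) (by
                have h1 : ({l ∈ insert i S | p l ≠ 0} : Finset (Fin n)) ⊆
                    insert i {l ∈ S | Function.update p i 1 l ≠ 0} := by
                  intro l hl
                  simp only [mem_filter, mem_insert] at hl ⊢
                  by_cases hli : l = i
                  · exact Or.inl hli
                  · right; rw [Function.update_of_ne hli]; tauto
                have h2 := (Finset.card_le_card h1).trans (Finset.card_insert_le _ _)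
                omega)
              refine h1.trans (le_of_eq ?_)
              by_cases hiS : i ∈ S
              · rw [Finset.insert_eq_of_mem hiS, Finset.prod_update_of_mem hiS,
                  Finset.sdiff_singleton_eq_erase, one_mul, mul_comm,
                  Finset.mul_prod_erase _ _ hiS]
              · rw [Finset.prod_insert hiS, Finset.prod_update_of_notMem hiS, mul_comm]
            · rw [Function.update_of_ne hjj]
              exact hother 1 j' hjj S hST hcard
      have hb0 : (1 - p i) * Ex n (Function.update p i 0)
          (fun x => if t0.steps x ≤ k then (1:ℝ) else 0) ≤
          (1 - p i) * ((1 - 0) * ∏ j' ∈ univ.erase j, (1 - α j')) := by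
        by_cases h : p i = 1
        · simp [h]
        · apply mul_le_mul_of_nonneg_left _ (by linarith [(hp i).2])
          rw [← hsplit]
          have hP0 := Prob_update n p hp i 0 (by norm_num)
          apply ih0 _ _ _ hP0 (CompOn_zero i t0 t1 f p hc h) _ _ (hcnt 0)
          · intro j'
            by_cases hjj : j' = j
            · subst hjj; simp
            · rw [Function.update_of_ne hjj]; exact hα j'
          · intro j' S hST hcard
            by_cases hjj : j' = j
            · subst hjj
              simp only [Function.update_self]
              exact (prod01 _ hP0 S).1
            · rw [Function.update_of_ne hjj]
              exact hother 0 j' hjj S hST hcard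
      have hfin : ∏ j', (1 - α j') = (1 - α j) * ∏ j' ∈ univ.erase j, (1 - α j') := by
        rw [← hsplit, Function.update_eq_self]
      have hdiv : p i * (α j / p i) = α j := by
        by_cases h : p i = 0
        · have := hS j {i} (by simpa using hj) (by simp [Finset.filter_singleton, h])
          simp only [prod_singleton, h] at this
          rw [h, zero_mul]
          linarith [hα j]
        · field_simp
      rw [hfin]
      refine (add_le_add hb1 hb0).trans (le_of_eq ?_)
      linear_combination (-∏ j' ∈ univ.erase j, (1 - α j')) * hdiv

lemma caseB {n m s : ℕ} (T : Fin m → Finset (Fin n)) (f : (Fin n → Bool) → Bool)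
    (hcard : ∀ j, (T j).card = s)
    (hcover : ∀ i : Fin n, ∃ j, i ∈ T j)
    (hf : IsReadOnceDNF n m T f) (p : Fin n → ℝ) (hp : ∀ i, 0 < p i ∧ p i < 1) :
    ∃ π : Equiv.Perm (Fin n), ∀ t : DecTree n, t.Computes f →
      naExpCost n f (fun _ => 1) p π ≤ m * adExpCost n (fun _ => 1) p t := by
  have hP : Prob n p := fun i => ⟨(hp i).1.le, (hp i).2.le⟩
  choose tm htm using hcover
  have htm' : ∀ i j, i ∈ T j → tm i = j := by
    intro i j hij
    by_contra hne
    exact Finset.disjoint_left.mp (hf.2.1 _ _ hne) (htm i) hij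
  choose r hr1 hr2 hr3 using fun j => exists_rank p (T j)
  simp only [hcard] at hr2
  obtain ⟨π, hπ⟩ := exists_perm_key n (fun i => r (tm i) i)
  refine ⟨π, fun t ht => ?_⟩
  -- the sets of variables tested in the first `k` rounds
  let A : ℕ → Fin m → Finset (Fin n) := fun k j => {i ∈ T j | r j i < k}
  have hAdisj : ∀ k, ∀ j j', j ≠ j' → Disjoint (A k j) (A k j') := fun k j j' h =>
    Finset.disjoint_of_subset_left (Finset.filter_subset _ _)
      (Finset.disjoint_of_subset_right (Finset.filter_subset _ _) (hf.2.1 j j' h))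
  have hA : ∑ k ∈ range s, (1 - D (A k) univ p) ≤ adExpCost n (fun _ => 1) p t := by
    have hbd : ∀ k ∈ range s, 1 - D (A k) univ p ≤
        Ex n p (fun x => 1 - if t.steps x ≤ k then (1:ℝ) else 0) := by
      intro k hk
      have hks := Finset.mem_range.1 hk
      have h := treeB T f (fun i => ⟨tm i, htm i⟩) hf t p k (fun j => ∏ i ∈ A k j, p i) hP
        (fun x _ => ht x) (fun j => (prod01 p hP _).1)
        (by
          intro j S hST hSk
          rw [Finset.filter_true_of_mem (fun i _ => (hp i).1.ne')] at hSk
          exact exch p hP (T j) (r j) (hr1 j) (by rw [hcard]; exact hr2 j) (hr3 j) k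
            (by rw [hcard]; omega) S hST hSk)
        (by
          intro j
          rw [Finset.filter_true_of_mem (fun i _ => (hp i).2.ne), hcard]
          exact hks)
      have e : Ex n p (fun x => 1 - if t.steps x ≤ k then (1:ℝ) else 0) =
          1 - Ex n p (fun x => if t.steps x ≤ k then (1:ℝ) else 0) := by
        have h1 := Ex_add n p (fun x => 1 - if t.steps x ≤ k then (1:ℝ) else 0)
          (fun x => if t.steps x ≤ k then (1:ℝ) else 0)
        simp only [sub_add_cancel, Ex_const] at h1
        linarith
      rw [e]
      unfold D
      linarith
    refine (Finset.sum_le_sum hbd).trans ?_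
    rw [← Ex_sum]
    change _ ≤ Ex n p _
    apply Ex_mono n p hP
    intro x
    rw [costOn_eq]
    have h1 : ∀ k : ℕ, (1 - if t.steps x ≤ k then (1:ℝ) else 0) =
        if k < t.steps x then 1 else 0 := by
      intro k
      by_cases h : t.steps x ≤ k
      · simp [h]
      · simp [h, not_le.1 h]
    simp only [h1]
    rw [Finset.sum_boole]
    have : #{k ∈ range s | k < t.steps x} ≤ #(range (t.steps x)) := by
      apply Finset.card_le_card
      intro k hk
      simp only [mem_filter, mem_range] at hk ⊢
      exact hk.2
    rw [Finset.card_range] at this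
    exact_mod_cast this
  have hN : naExpCost n f (fun _ => 1) p π ≤ m * ∑ k ∈ range s, (1 - D (A k) univ p) := by
    have e : ∑ k ∈ range s, (1 - D (A k) univ p) = Ex n p (fun x => ∑ k ∈ range s,
        (1 - D (A k) univ (fun i => if x i then 1 else 0))) := by
      rw [Ex_sum]
      apply Finset.sum_congr rfl
      intro k _
      refine (Ex_eval n (fun p => 1 - D (A k) univ p) (fun p i => ?_) p).symm
      have := D_affine (A k) (hAdisj k) univ p i
      linear_combination -this
    rw [e, ← Ex_smul]
    change Ex n p _ ≤ _
    apply Ex_mono n p hP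
    intro x
    have hxP : Prob n (fun i => if x i then 1 else 0) := by
      intro i; dsimp only; split_ifs <;> norm_num
    -- choose the stopping round
    have hex : ∃ k, k = s ∨ ∀ j, ∃ i ∈ A k j, x i = false := ⟨s, Or.inl rfl⟩
    classical
    obtain ⟨k, hk, hkmin⟩ : ∃ k, (k = s ∨ ∀ j, ∃ i ∈ A k j, x i = false) ∧
        ∀ k' < k, ¬ (k' = s ∨ ∀ j, ∃ i ∈ A k' j, x i = false) :=
      ⟨Nat.find hex, Nat.find_spec hex, fun k' h => Nat.find_min hex h⟩
    have hks : k ≤ s := by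
      by_contra h
      exact hkmin s (by omega) (Or.inl rfl)
    have hsum : (k : ℝ) ≤ ∑ k ∈ range s, (1 - D (A k) univ (fun i => if x i then 1 else 0)) := by
      have h1 : (k : ℝ) = ∑ _k ∈ range k, (1 : ℝ) := by simp
      rw [h1]
      calc ∑ _k ∈ range k, (1 : ℝ) ≤
          ∑ k ∈ range k, (1 - D (A k) univ (fun i => if x i then 1 else 0)) := by
            apply Finset.sum_le_sum
            intro k' hk'
            have h2 := hkmin k' (Finset.mem_range.1 hk')
            push Not at h2
            obtain ⟨j, hj⟩ := h2.2
            have : D (A k') univ (fun i => if x i then (1:ℝ) else 0) = 0 := by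
              unfold D
              apply Finset.prod_eq_zero (mem_univ j)
              rw [Finset.prod_eq_one, sub_self]
              intro i hi
              have := hj i hi
              simp at this
              simp [this]
            rw [this, sub_zero]
        _ ≤ _ := by
            apply Finset.sum_le_sum_of_subset_of_nonneg
            · exact Finset.range_subset_range.2 hks
            · intro k' _ _
              linarith [(D01 (A k') univ _ hxP).2]
    refine le_trans ?_ (mul_le_mul_of_nonneg_left hsum (by positivity))
    have hdet : Determines n f ({i | r (tm i) i < k} : Finset (Fin n)) x := by
      rcases hk with h | h
      · apply determines_univ
        intro i
        simp only [mem_filter, mem_univ, true_and, h]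
        exact hr2 _ i (htm i)
      · intro x' hx'
        have hfalse : ∀ y : Fin n → Bool, (∀ j, ∃ i ∈ T j, y i = false) → f y = false := by
          intro y hy
          by_contra hne
          rw [Bool.not_eq_false] at hne
          obtain ⟨j, hj⟩ := (hf.2.2 y).1 hne
          obtain ⟨i, hi, h0⟩ := hy j
          rw [hj i hi] at h0
          simp at h0
        rw [hfalse x, hfalse x']
        · intro j
          obtain ⟨i, hi, h0⟩ := h j
          simp only [A, mem_filter] at hi
          refine ⟨i, hi.1, ?_⟩
          rw [hx' i, h0]
          simp only [mem_filter, mem_univ, true_and]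
          rw [htm' i j hi.1]; exact hi.2
        · intro j
          obtain ⟨i, hi, h0⟩ := h j
          exact ⟨i, (Finset.mem_filter.1 hi).1, h0⟩
    rw [← hπ k] at hdet
    refine (naCost_le n f π x _ hdet).trans ?_
    have hc : #{i | r (tm i) i < k} ≤ m * #(Finset.range k) := by
      apply Finset.card_le_mul_card_image_of_maps_to (f := fun i => r (tm i) i)
      · intro i hi; simpa using hi
      · intro b hb
        have : #{i ∈ ({i | r (tm i) i < k} : Finset (Fin n)) | r (tm i) i = b} ≤
            #(univ : Finset (Fin m)) := by
          apply Finset.card_le_card_of_injOn tm (by simp)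
          intro i hi i' hi' h
          replace hi := Finset.mem_filter.1 hi
          replace hi' := Finset.mem_filter.1 hi'
          apply hr1 (tm i) i (htm i) i' (by rw [h]; exact htm i')
          rw [hi.2]
          conv_rhs => rw [h]
          exact hi'.2.symm
        simpa using this
    rw [Finset.card_range] at hc
    exact_mod_cast hc
  exact hN.trans (mul_le_mul_of_nonneg_left hA (by positivity))

/-- For a monotone read-once DNF `f` with `m` terms, each containing exactly `n/m`
variables (so every variable appears in exactly one term), under unit costs and
arbitrary probabilities there is a non-adaptive strategy of expected cost at most
`min{n/m, m}·OPT_A(f) ≤ √n·OPT_A(f)`. -/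
theorem stmt4 (n m : ℕ) (hm : 0 < m) (hdvd : m ∣ n)
    (T : Fin m → Finset (Fin n)) (f : (Fin n → Bool) → Bool)
    (hcard : ∀ j, (T j).card = n / m)
    (hcover : ∀ i : Fin n, ∃ j, i ∈ T j)
    (hf : IsReadOnceDNF n m T f)
    (p : Fin n → ℝ) (hp : ∀ i, 0 < p i ∧ p i < 1) :
    ∃ π : Equiv.Perm (Fin n),
      naExpCost n f (fun _ => 1) p π ≤
        min ((n : ℝ) / m) (m : ℝ) * OPTA n f (fun _ => 1) p ∧
      naExpCost n f (fun _ => 1) p π ≤ Real.sqrt n * OPTA n f (fun _ => 1) p := by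
  obtain ⟨s, hs⟩ := hdvd
  have hns : n / m = s := by rw [hs]; exact Nat.mul_div_cancel_left s hm
  have hm' : (0:ℝ) < m := by exact_mod_cast hm
  have hnsR : (n : ℝ) / m = s := by
    rw [hs]; push_cast; field_simp
  rw [hns] at hcard
  have hne : {r : ℝ | ∃ t : DecTree n, DecTree.Computes t f ∧
      r = adExpCost n (fun _ => 1) p t}.Nonempty := by
    obtain ⟨t, ht⟩ := exists_tree (List.finRange n) f (fun x y h => by
      congr 1; funext i; exact h i (by simp))
    exact ⟨_, t, ht, rfl⟩
  have hopt : 0 ≤ OPTA n f (fun _ => 1) p := by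
    apply Real.sInf_nonneg
    rintro r ⟨t, _, rfl⟩
    unfold adExpCost
    apply Finset.sum_nonneg
    intro x _
    rw [costOn_eq]
    exact mul_nonneg (prodWeight_nonneg n p (fun i => ⟨(hp i).1.le, (hp i).2.le⟩) x)
      (by positivity)
  have fin : ∀ (c : ℝ) (π : Equiv.Perm (Fin n)), 0 ≤ c → (∀ t : DecTree n, t.Computes f →
      naExpCost n f (fun _ => 1) p π ≤ c * adExpCost n (fun _ => 1) p t) →
      naExpCost n f (fun _ => 1) p π ≤ c * OPTA n f (fun _ => 1) p := by
    intro c π hc h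
    rcases hc.eq_or_lt with h0 | h0
    · obtain ⟨_, t, ht, _⟩ := hne
      have := h t ht
      rw [← h0, zero_mul] at this ⊢
      exact this
    · rw [← div_le_iff₀' h0]
      apply le_csInf hne
      rintro r ⟨t, ht, rfl⟩
      rw [div_le_iff₀' h0]
      exact h t ht
  have main : ∃ π : Equiv.Perm (Fin n), naExpCost n f (fun _ => 1) p π ≤
      min ((n : ℝ) / m) (m : ℝ) * OPTA n f (fun _ => 1) p := by
    rw [hnsR]
    rcases le_total (s : ℝ) (m : ℝ) with h | h
    · rw [min_eq_left h]
      obtain ⟨π, hπ⟩ := caseA T f hcard hcover hf p hp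
      exact ⟨π, fin _ π (by positivity) hπ⟩
    · rw [min_eq_right h]
      obtain ⟨π, hπ⟩ := caseB T f hcard hcover hf p hp
      exact ⟨π, fin _ π (by positivity) hπ⟩
  obtain ⟨π, hπ⟩ := main
  refine ⟨π, hπ, hπ.trans (mul_le_mul_of_nonneg_right ?_ hopt)⟩
  apply Real.le_sqrt_of_sq_le
  rw [hnsR, hs]
  push_cast
  have h1 : min (s:ℝ) m ≤ s := min_le_left _ _
  have h2 : min (s:ℝ) m ≤ m := min_le_right _ _
  have h3 : 0 ≤ min (s:ℝ) m := le_min (by positivity) (by positivity)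
  nlinarith
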